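/- arXiv:1604.02755 — 4 statements merged into one kernel-verified Lean document; each statement's English description precedes it below -/
import Mathlib

section
/- Let n, k, N be positive integers with N ≥ 2(k+1), and suppose there exists an (n,k) circuit code of length N. Let q = ⌈N/(2(k+1))⌉ and r = ⌈log₂(N/(2(k+1)))⌉ + 1 (logarithm of the real number N/(2(k+1))). Then there exists an (n+r, k+1) circuit code of length N' = N + 2q. -/
/-- The cyclic distance between two positions on a cycle of length `N`:
the minimum of the two arc lengths. -/
def cycDist {N : ℕ} (i j : ZMod N) : ℕ := min (j - i).val (i - j).val

/-- `C` is an `(n,k)` circuit code of length `N`: a cyclic sequence of `N` distinct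
vertices of the hypercube `I(n)` forming an induced cycle such that vertices at
Hamming distance `< k` are at equal cyclic distance. -/
structure IsCircuitCode (n k N : ℕ) (C : ZMod N → (Fin n → Bool)) : Prop where
  inj : Function.Injective C
  adj : ∀ i : ZMod N, hammingDist (C i) (C (i + 1)) = 1
  induced : ∀ i j : ZMod N, i ≠ j → j ≠ i + 1 → i ≠ j + 1 →
    hammingDist (C i) (C j) ≠ 1
  spread : ∀ i j : ZMod N, hammingDist (C i) (C j) < k →
    cycDist i j = hammingDist (C i) (C j)

/-- There exists an `(n,k)` circuit code of length `N`. -/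
def ExistsCircuitCode (n k N : ℕ) : Prop :=
  ∃ C : ZMod N → (Fin n → Bool), IsCircuitCode n k N C

/-- `K n k` is the maximum length of an `(n,k)` circuit code. -/
noncomputable def K (n k : ℕ) : ℕ := sSup {N | ExistsCircuitCode n k N}

/-- Reduction modulo `2` of the Hamming distance is additive along triples of Boolean words. -/
theorem hammingDist_cast_zmod_two_add {n : ℕ} (x y z : Fin n → Bool) :
    (hammingDist x z : ZMod 2) = hammingDist x y + hammingDist y z := by
  simp only [hammingDist, Finset.card_filter, Nat.cast_sum, ← Finset.sum_add_distrib]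
  refine Finset.sum_congr rfl fun i _ => ?_
  cases x i <;> cases y i <;> cases z i <;> decide

theorem hammingDist_fin_append {m n : ℕ} (x x' : Fin m → Bool) (y y' : Fin n → Bool) :
    hammingDist (Fin.append x y) (Fin.append x' y') = hammingDist x x' + hammingDist y y' := by
  simp [hammingDist, Finset.card_filter, Fin.sum_univ_add]

theorem hammingDist_fin_snoc {n : ℕ} (x x' : Fin n → Bool) (b b' : Bool) :
    hammingDist (Fin.snoc x b : Fin (n + 1) → Bool) (Fin.snoc x' b' : Fin (n + 1) → Bool) =
      hammingDist x x' + if b = b' then 0 else 1 := by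
  simp [hammingDist, Finset.card_filter, Fin.sum_univ_castSucc]

/-- `u 0, …, u (m - 1)` is a path of distinct vertices of the hypercube. -/
structure IsCubePath (s m : ℕ) (u : ℕ → Fin s → Bool) : Prop where
  inj : ∀ i j, i < m → j < m → u i = u j → i = j
  adj : ∀ i, i + 1 < m → hammingDist (u i) (u (i + 1)) = 1

/-- Traversing a path in one facet and then backwards in the opposite facet. -/
def reflectPath {s : ℕ} (m : ℕ) (u : ℕ → Fin s → Bool) (i : ℕ) : Fin (s + 1) → Bool :=
  if i < m then Fin.snoc (u i) false else Fin.snoc (u (2 * m - 1 - i)) true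

theorem IsCubePath.reflect {s m : ℕ} {u : ℕ → Fin s → Bool} (h : IsCubePath s m u) :
    IsCubePath (s + 1) (2 * m) (reflectPath m u) := by
  constructor
  · intro i j hi hj hij
    unfold reflectPath at hij
    split_ifs at hij with h1 h2 h2
    · exact h.inj i j h1 h2 (Fin.snoc_injective2 hij).1
    · simpa using (Fin.snoc_injective2 hij).2
    · simpa using (Fin.snoc_injective2 hij).2
    · have := h.inj _ _ (by omega) (by omega) (Fin.snoc_injective2 hij).1
      omega
  · intro i hi
    unfold reflectPath
    split_ifs with h1 h2 h2
    · simpa [hammingDist_fin_snoc] using h.adj i h2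
    · rw [hammingDist_fin_snoc, show 2 * m - 1 - (i + 1) = i by omega]
      simp
    · omega
    · have := h.adj (2 * m - 1 - (i + 1)) (by omega)
      rw [show 2 * m - 1 - (i + 1) + 1 = 2 * m - 1 - i by omega, hammingDist_comm] at this
      simpa [hammingDist_fin_snoc] using this

theorem hammingDist_reflectPath_last {s m : ℕ} (hm : 0 < m) (u : ℕ → Fin s → Bool) :
    hammingDist (reflectPath m u (2 * m - 1)) (reflectPath m u 0) = 1 := by
  unfold reflectPath
  rw [if_neg (by omega), if_pos hm, Nat.sub_self, hammingDist_fin_snoc]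
  simp

theorem exists_isCubePath (s m : ℕ) (hm : m ≤ 2 ^ s) : ∃ u, IsCubePath s m u := by
  have key : ∃ u, IsCubePath s (2 ^ s) u := by
    clear hm
    induction s with
    | zero => exact ⟨fun _ => Fin.elim0, fun i j hi hj _ => by omega, fun i hi => by omega⟩
    | succ s ih =>
      obtain ⟨u, hu⟩ := ih
      exact ⟨_, by rw [pow_succ']; exact hu.reflect⟩
  obtain ⟨u, hu⟩ := key
  exact ⟨u, fun i j hi hj => hu.inj i j (by omega) (by omega), fun i hi => hu.adj i (by omega)⟩

/-- The hypercube `I(s + 1)` has closed walks through `2 q` distinct vertices for all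
`0 < q ≤ 2 ^ s`. -/
theorem exists_periodic_cube_cycle {s q : ℕ} (hq : 0 < q) (hqs : q ≤ 2 ^ s) :
    ∃ w : ℕ → Fin (s + 1) → Bool, Function.Periodic w (2 * q) ∧
      (∀ i, hammingDist (w i) (w (i + 1)) = 1) ∧
      ∀ i d, 0 < d → d < 2 * q → w i ≠ w (i + d) := by
  obtain ⟨u, hu⟩ := exists_isCubePath s q hqs
  have hv := hu.reflect
  refine ⟨fun i => reflectPath q u (i % (2 * q)), fun i => by simp, fun i => ?_,
    fun i d hd hdq h => ?_⟩
  · have hlt := Nat.mod_lt i (show 0 < 2 * q by omega)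
    by_cases hi : i % (2 * q) + 1 < 2 * q
    · have h1 : (i + 1) % (2 * q) = i % (2 * q) + 1 := by
        rw [← Nat.mod_add_mod, Nat.mod_eq_of_lt hi]
      simpa only [h1] using hv.adj _ hi
    · have h1 : (i + 1) % (2 * q) = 0 := by
        rw [← Nat.mod_add_mod, show i % (2 * q) + 1 = 2 * q by omega, Nat.mod_self]
      have h2 : i % (2 * q) = 2 * q - 1 := by omega
      simpa only [h1, h2] using hammingDist_reflectPath_last hq u
  · have hpos : 0 < 2 * q := by omega
    have h1 : i ≡ i + d [MOD 2 * q] :=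
      hv.inj _ _ (Nat.mod_lt _ hpos) (Nat.mod_lt _ hpos) h
    have h2 : 2 * q ∣ d := by simpa using (Nat.modEq_iff_dvd' (Nat.le_add_right i d)).1 h1
    exact absurd (Nat.le_of_dvd hd h2) (by omega)

theorem cycDist_comm {N : ℕ} (i j : ZMod N) : cycDist i j = cycDist j i := min_comm _ _

theorem cycDist_natCast_add {N z δ : ℕ} (hN : 0 < N) (hδ : 2 * δ ≤ N) :
    cycDist (z : ZMod N) ((z + δ : ℕ) : ZMod N) = δ := by
  have : NeZero N := ⟨hN.ne'⟩
  have h1 : (δ : ZMod N).val = δ := ZMod.val_cast_of_lt (by omega)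
  rw [cycDist, Nat.cast_add, add_sub_cancel_left, sub_add_cancel_left, ZMod.neg_val, h1]
  split_ifs with h
  · rw [h, ZMod.val_zero] at h1
    omega
  · omega

/-- A circuit code of spread at least `2`, presented as a periodic sequence. -/
theorem existsCircuitCode_of_periodic {n k N : ℕ} (hN : 0 < N) (hk : 2 ≤ k)
    (F : ℕ → Fin n → Bool) (hF : Function.Periodic F N)
    (hadj : ∀ z, hammingDist (F z) (F (z + 1)) = 1)
    (hspread : ∀ z δ, 2 * δ ≤ N → hammingDist (F z) (F (z + δ)) < k →
      hammingDist (F z) (F (z + δ)) = δ) :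
    ExistsCircuitCode n k N := by
  have : NeZero N := ⟨hN.ne'⟩
  have hcast (z : ℕ) : F (z : ZMod N).val = F z := by
    rw [ZMod.val_natCast, hF.map_mod_nat]
  have aux (i j : ZMod N) (hij : 2 * (j - i).val ≤ N)
      (hd : hammingDist (F i.val) (F j.val) < k) :
      cycDist i j = hammingDist (F i.val) (F j.val) := by
    have hj : ((i.val + (j - i).val : ℕ) : ZMod N) = j := by simp
    have hc := cycDist_natCast_add (z := i.val) hN hij
    have hFj := hcast (i.val + (j - i).val)
    rw [hj] at hc hFj
    rw [ZMod.natCast_zmod_val] at hc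
    rw [hFj] at hd ⊢
    rw [hc, hspread _ _ hij hd]
  have main (i j : ZMod N) (hd : hammingDist (F i.val) (F j.val) < k) :
      cycDist i j = hammingDist (F i.val) (F j.val) := by
    by_cases hij : 2 * (j - i).val ≤ N
    · exact aux i j hij hd
    · rw [cycDist_comm, hammingDist_comm]
      rw [hammingDist_comm] at hd
      refine aux j i ?_ hd
      rw [← neg_sub j i, ZMod.neg_val]
      split_ifs <;> omega
  have val_cases (i j : ZMod N) (m : ℕ) (h : cycDist i j = m) : j = i + m ∨ i = j + m := by
    unfold cycDist at h
    rcases min_choice (j - i).val (i - j).val with h' | h' <;> rw [h'] at h <;> subst h <;> simp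
  refine ⟨fun i => F i.val, fun i j hij => ?_, fun i => ?_, fun i j hij h1 h2 h => ?_, main⟩
  · have hij : F i.val = F j.val := hij
    have h := main i j (by rw [hij, hammingDist_self]; omega)
    rw [hij, hammingDist_self] at h
    rcases val_cases i j 0 h with h | h <;> simp [h]
  · have := hadj i.val
    rwa [← hcast (i.val + 1), Nat.cast_add, ZMod.natCast_zmod_val, Nat.cast_one] at this
  · have h := (main i j (by omega)).trans h
    rcases val_cases i j 1 h with h | h <;> simp_all

/-- If consecutive words are adjacent, the Hamming distance has the parity of the index shift. -/
theorem hammingDist_cast_zmod_two_of_adj {n : ℕ} (F : ℕ → Fin n → Bool)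
    (hadj : ∀ z, hammingDist (F z) (F (z + 1)) = 1) (z δ : ℕ) :
    (hammingDist (F z) (F (z + δ)) : ZMod 2) = δ := by
  induction δ with
  | zero => simp
  | succ δ ih =>
    rw [hammingDist_cast_zmod_two_add _ (F (z + δ)), ih, ← add_assoc, hadj]
    simp

theorem hammingDist_le_of_adj {n : ℕ} (F : ℕ → Fin n → Bool)
    (hadj : ∀ z, hammingDist (F z) (F (z + 1)) = 1) (z δ : ℕ) :
    hammingDist (F z) (F (z + δ)) ≤ δ := by
  induction δ with
  | zero => simp
  | succ δ ih =>
    have := hammingDist_triangle (F z) (F (z + δ)) (F (z + δ + 1))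
    rw [hadj] at this
    rw [← add_assoc]
    omega

/-- An evenly distributed interleaving of two cycles of even lengths `N` and `2 q`: `a p` and
`b p` count the steps made on either cycle during the first `p` steps. -/
theorem exists_balanced_interleaving {N q : ℕ} (hNe : Even N) (hN : 0 < N) :
    ∃ a b : ℕ → ℕ,
      (∀ p, a (p + (N + 2 * q)) = a p + N ∧ b (p + (N + 2 * q)) = b p + 2 * q) ∧
      (∀ p, a (p + 1) = a p + 1 ∧ b (p + 1) = b p ∨
        a (p + 1) = a p ∧ b (p + 1) = b p + 1) ∧
      ∀ p δ, 2 * δ ≤ N + 2 * q → ∃ A B, a (p + δ) = a p + A ∧ b (p + δ) = b p + B ∧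
        A + B = δ ∧ 2 * A ≤ N ∧ B ≤ q ∧ δ * (2 * q) < (B + 1) * (N + 2 * q) ∧
        B * (N + 2 * q) < δ * (2 * q) + (N + 2 * q) := by
  set M := N + 2 * q with hM
  have hMpos : 0 < M := by omega
  let b : ℕ → ℕ := fun p => p * (2 * q) / M
  have hlo (p : ℕ) : b p * M ≤ p * (2 * q) := Nat.div_mul_le_self _ _
  have hhi (p : ℕ) : p * (2 * q) < (b p + 1) * M := by
    rw [mul_comm (b p + 1)]; exact Nat.lt_mul_div_succ _ hMpos
  have hbp (p : ℕ) : b p ≤ p := by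
    by_contra! h
    nlinarith [hlo p]
  have hmono (p δ : ℕ) : b p ≤ b (p + δ) :=
    Nat.div_le_div_right (Nat.mul_le_mul_right _ (Nat.le_add_right p δ))
  have hgap (p δ : ℕ) : ∃ B, b (p + δ) = b p + B ∧ B ≤ δ ∧
      δ * (2 * q) < (B + 1) * M ∧ B * M < δ * (2 * q) + M := by
    obtain ⟨B, hB⟩ := Nat.exists_eq_add_of_le (hmono p δ)
    have h1 := hlo p
    have h2 := hhi p
    have h3 := hlo (p + δ)
    have h4 := hhi (p + δ)
    rw [hB] at h3 h4
    have h5 : δ * (2 * q) < (B + 1) * M := by nlinarith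
    have h6 : B * M < δ * (2 * q) + M := by nlinarith
    refine ⟨B, hB, ?_, h5, h6⟩
    by_contra! h
    nlinarith
  have hper (p : ℕ) : b (p + M) = b p + 2 * q := by
    change (p + M) * (2 * q) / M = p * (2 * q) / M + 2 * q
    rw [add_mul, Nat.add_mul_div_left _ _ hMpos]
  refine ⟨fun p => p - b p, b, fun p => ⟨?_, hper p⟩, fun p => ?_, fun p δ hδ => ?_⟩
  · have := hper p
    have := hbp p
    dsimp only
    omega
  · obtain ⟨B, hB, hB1, -⟩ := hgap p 1
    have := hbp p
    dsimp only
    omega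
  · obtain ⟨B, hB, hBδ, h5, h6⟩ := hgap p δ
    have := hbp p
    obtain ⟨A, rfl⟩ := Nat.exists_eq_add_of_le hBδ
    obtain ⟨c, rfl⟩ := hNe
    refine ⟨A, B, by dsimp only; omega, hB, by omega, ?_, ?_, h5, h6⟩
    · by_contra! h
      have : c + 1 ≤ A := by omega
      nlinarith
    · by_contra! h
      have : q + 1 ≤ B := by omega
      nlinarith

theorem stmt_0 (n k N : ℕ) (hn : 0 < n) (hk : 0 < k) (hNpos : 0 < N)
    (hN : 2 * (k + 1) ≤ N) (h : ExistsCircuitCode n k N)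
    (q r : ℕ) (hq : q = ⌈(N : ℝ) / (2 * (k + 1))⌉₊)
    (hr : r = ⌈Real.logb 2 ((N : ℝ) / (2 * (k + 1)))⌉₊ + 1) :
    ExistsCircuitCode (n + r) (k + 1) (N + 2 * q) := by
  have hk2 : (0 : ℝ) < 2 * (k + 1) := by positivity
  have hx : (0 : ℝ) < (N : ℝ) / (2 * (k + 1)) := by positivity
  have hqpos : 0 < q := by rw [hq]; exact Nat.ceil_pos.2 hx
  have hNq : N ≤ 2 * (k + 1) * q := by
    have h1 := Nat.le_ceil ((N : ℝ) / (2 * (k + 1)))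
    rw [← hq, div_le_iff₀ hk2] at h1
    have h2 : (N : ℝ) ≤ ((2 * (k + 1) * q : ℕ) : ℝ) := by push_cast; linarith
    exact_mod_cast h2
  have hqN : 2 * (k + 1) * q < N + 2 * (k + 1) := by
    have h1 := Nat.ceil_lt_add_one hx.le
    rw [← hq, ← sub_lt_iff_lt_add, lt_div_iff₀ hk2] at h1
    have h2 : ((2 * (k + 1) * q : ℕ) : ℝ) < ((N + 2 * (k + 1) : ℕ) : ℝ) := by
      push_cast; linarith
    exact_mod_cast h2
  obtain ⟨s, hs⟩ : ∃ s, s = ⌈Real.logb 2 ((N : ℝ) / (2 * (k + 1)))⌉₊ := ⟨_, rfl⟩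
  rw [← hs] at hr
  subst hr
  have hqs : q ≤ 2 ^ s := by
    have h1 := Nat.le_ceil (Real.logb 2 ((N : ℝ) / (2 * (k + 1))))
    rw [← hs, Real.logb_le_iff_le_rpow one_lt_two hx, Real.rpow_natCast] at h1
    rw [hq, Nat.ceil_le]
    exact_mod_cast h1
  obtain ⟨w, hwper, hwadj, hwne⟩ := exists_periodic_cube_cycle hqpos hqs
  obtain ⟨C, hC⟩ := h
  let F : ℕ → Fin n → Bool := fun z => C (z : ZMod N)
  have hFper : Function.Periodic F N := fun z => by simp [F]
  have hFadj (z : ℕ) : hammingDist (F z) (F (z + 1)) = 1 := by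
    simpa [F] using hC.adj (z : ZMod N)
  have hFspread (z δ : ℕ) (hδ : 2 * δ ≤ N) (hd : hammingDist (F z) (F (z + δ)) < k) :
      hammingDist (F z) (F (z + δ)) = δ :=
    (hC.spread _ _ hd).symm.trans (cycDist_natCast_add hNpos hδ)
  have hNe : Even N := by
    have := hammingDist_cast_zmod_two_of_adj F hFadj 0 N
    rw [hFper 0, hammingDist_self, Nat.cast_zero] at this
    exact (ZMod.natCast_eq_zero_iff_even).1 this.symm
  obtain ⟨a, b, hper, hstep, hgap⟩ := exists_balanced_interleaving (q := q) hNe hNpos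
  refine existsCircuitCode_of_periodic (by omega) (by omega)
    (fun p => Fin.append (F (a p)) (w (b p))) (fun p => ?_) (fun p => ?_) fun p δ hδ hd => ?_
  · dsimp only
    rw [(hper p).1, (hper p).2, hFper, hwper]
  · rw [hammingDist_fin_append]
    rcases hstep p with ⟨h1, h2⟩ | ⟨h1, h2⟩ <;> simp [h1, h2, hFadj, hwadj]
  · obtain ⟨A, B, hA, hB, hAB, hAN, hBq, h5, h6⟩ := hgap p δ hδ
    rw [hammingDist_fin_append, hA, hB] at hd ⊢
    have hFle := hammingDist_le_of_adj F hFadj (a p) A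
    have hwle := hammingDist_le_of_adj w hwadj (b p) B
    have hFpar := hammingDist_cast_zmod_two_of_adj F hFadj (a p) A
    have hwpar := hammingDist_cast_zmod_two_of_adj w hwadj (b p) B
    rw [ZMod.natCast_eq_natCast_iff'] at hFpar hwpar
    have hFs := hFspread (a p) A hAN
    rcases Nat.eq_zero_or_pos B with rfl | hBpos
    · obtain rfl : A = δ := by omega
      have hAk : A ≤ k + 1 := by
        by_contra! h
        have : k + 2 ≤ A := by omega
        nlinarith
      omega
    · have hw : 0 < hammingDist (w (b p)) (w (b p + B)) :=
        hammingDist_pos.2 (hwne _ _ hBpos (by omega))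
      have hB2 : B ≤ 2 := by
        by_contra! h
        have h7 : A + 1 ≤ k := by omega
        have h8 : (B - 1) * N < (A + 1) * (2 * q) := by
          obtain ⟨B', rfl⟩ := Nat.exists_eq_add_of_le' hBpos
          subst hAB
          simp only [Nat.add_sub_cancel]
          nlinarith
        have h9 : 2 * N ≤ (B - 1) * N := Nat.mul_le_mul_right _ (by omega)
        have h10 : (A + 1) * (2 * q) ≤ k * (2 * q) := Nat.mul_le_mul_right _ h7
        nlinarith
      omega
end

section
/- For every natural number n ≥ 6, K(⌊1.53·n⌋, 4) ≥ 40 · 3^((n−8)/3), where the right-hand side is a real power and K is compared as a real number. -/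
/-- The cyclic distance is at most the absolute value of any integer representing the difference. -/
lemma cycDist_le_natAbs {N : ℕ} [NeZero N] {i j : ZMod N} {x : ℤ} (h : j - i = (x : ZMod N)) :
    cycDist i j ≤ x.natAbs := by
  obtain ⟨a, rfl | rfl⟩ := x.eq_nat_or_neg
  · refine (min_le_left _ _).trans ?_
    rw [h, Int.cast_natCast, ZMod.val_natCast, Int.natAbs_natCast]
    exact Nat.mod_le a N
  · refine (min_le_right _ _).trans ?_
    have h' : i - j = (a : ZMod N) := by
      rw [← neg_sub, h, Int.cast_neg, neg_neg, Int.cast_natCast]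
    rw [h', ZMod.val_natCast, Int.natAbs_neg, Int.natAbs_natCast]
    exact Nat.mod_le a N

/-- The cyclic distance is attained by an integer representing the difference. -/
lemma exists_natAbs_eq_cycDist {N : ℕ} [NeZero N] (i j : ZMod N) :
    ∃ x : ℤ, j - i = (x : ZMod N) ∧ x.natAbs = cycDist i j := by
  rcases min_choice (j - i).val (i - j).val with h | h
  · exact ⟨(j - i).val, by simp, by rw [cycDist, h]; omega⟩
  · exact ⟨-(i - j).val, by simp, by rw [cycDist, h]; omega⟩

lemma hammingDist_add_natCast_le {n N : ℕ} {C : ZMod N → Fin n → Bool}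
    (adj : ∀ i, hammingDist (C i) (C (i + 1)) = 1) (i : ZMod N) (d : ℕ) :
    hammingDist (C i) (C (i + d)) ≤ d := by
  induction d with
  | zero => simp
  | succ d ih =>
    have h1 := hammingDist_triangle (C i) (C (i + d)) (C (i + d + 1))
    have h2 := adj (i + d)
    push_cast
    rw [← add_assoc]
    omega

/-- Along a cyclic sequence with unit steps, Hamming distance is at most cyclic distance. -/
lemma hammingDist_le_cycDist {n N : ℕ} [NeZero N] {C : ZMod N → Fin n → Bool}
    (adj : ∀ i, hammingDist (C i) (C (i + 1)) = 1) (i j : ZMod N) :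
    hammingDist (C i) (C j) ≤ cycDist i j := by
  refine le_min ?_ ?_
  · simpa using hammingDist_add_natCast_le adj i (j - i).val
  · rw [hammingDist_comm]
    simpa using hammingDist_add_natCast_le adj j (i - j).val

/-- A cyclic sequence with unit steps, in which vertices at Hamming distance `< k` have cyclic
distance at most their Hamming distance, is a circuit code. -/
lemma IsCircuitCode.of_cycDist_le {n k N : ℕ} [NeZero N] (hk : 2 ≤ k)
    {C : ZMod N → Fin n → Bool} (adj : ∀ i, hammingDist (C i) (C (i + 1)) = 1)
    (spread : ∀ i j, hammingDist (C i) (C j) < k → cycDist i j ≤ hammingDist (C i) (C j)) :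
    IsCircuitCode n k N C where
  adj := adj
  spread i j h := le_antisymm (spread i j h) (hammingDist_le_cycDist adj i j)
  inj i j h := by
    have h0 : hammingDist (C i) (C j) = 0 := by rw [h, hammingDist_self]
    obtain ⟨x, hx, hx'⟩ := exists_natAbs_eq_cycDist i j
    have h1 := spread i j (by omega)
    have h2 : x = 0 := by omega
    rw [h2, Int.cast_zero, sub_eq_zero] at hx
    exact hx.symm
  induced i j hij hj hi h := by
    obtain ⟨x, hx, hx'⟩ := exists_natAbs_eq_cycDist i j
    have h1 := spread i j (by omega)
    have h2 : x = 0 ∨ x = 1 ∨ x = -1 := by omega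
    rcases h2 with rfl | rfl | rfl
    · rw [Int.cast_zero, sub_eq_zero] at hx
      exact hij hx.symm
    · rw [Int.cast_one, sub_eq_iff_eq_add'] at hx
      exact hj hx
    · rw [Int.cast_neg, Int.cast_one, sub_eq_iff_eq_add', ← sub_eq_add_neg, eq_sub_iff_add_eq] at hx
      exact hi hx.symm

/-- A circuit code may be given as a periodic sequence indexed by the integers. -/
lemma ExistsCircuitCode.of_periodic {n k N : ℕ} [NeZero N] (hk : 2 ≤ k) (F : ℤ → Fin n → Bool)
    (per : ∀ t q : ℤ, F (t + N * q) = F t) (adj : ∀ t, hammingDist (F t) (F (t + 1)) = 1)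
    (spread : ∀ t u, hammingDist (F t) (F u) < k →
      ∃ q : ℤ, (u + N * q - t).natAbs ≤ hammingDist (F t) (F u)) :
    ExistsCircuitCode n k N := by
  have key : ∀ t : ℤ, F (((t : ZMod N)).val : ℤ) = F t := by
    intro t
    rw [ZMod.val_intCast, ← per (t % N) (t / N), Int.emod_add_mul_ediv]
  refine ⟨fun i => F (i.val : ℤ), IsCircuitCode.of_cycDist_le hk ?_ ?_⟩
  · intro i
    obtain ⟨t, rfl⟩ := ZMod.intCast_surjective i
    have h1 : ((t : ZMod N) + 1) = ((t + 1 : ℤ) : ZMod N) := by push_cast; rfl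
    simp only [h1, key]
    exact adj t
  · intro i j
    obtain ⟨t, rfl⟩ := ZMod.intCast_surjective i
    obtain ⟨u, rfl⟩ := ZMod.intCast_surjective j
    simp only [key]
    intro h
    obtain ⟨q, hq⟩ := spread t u h
    exact (cycDist_le_natAbs (by push_cast; simp)).trans hq

lemma hammingDist_append {n m : ℕ} (a a' : Fin n → Bool) (b b' : Fin m → Bool) :
    hammingDist (Fin.append a b : Fin (n + m) → Bool) (Fin.append a' b') =
      hammingDist a a' + hammingDist b b' := by
  simp only [hammingDist, Finset.card_filter, Fin.sum_univ_add, Fin.append_left, Fin.append_right]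

lemma ExistsCircuitCode.succ {n k N : ℕ} (h : ExistsCircuitCode n k N) :
    ExistsCircuitCode (n + 1) k N := by
  obtain ⟨C, hC⟩ := h
  have key : ∀ i j, hammingDist
      (Fin.append (C i) (fun _ => false : Fin 1 → Bool) : Fin (n + 1) → Bool)
      (Fin.append (C j) (fun _ => false : Fin 1 → Bool)) = hammingDist (C i) (C j) := by
    intro i j
    rw [hammingDist_append, hammingDist_self, add_zero]
  refine ⟨fun i => Fin.append (C i) (fun _ => false : Fin 1 → Bool), ?_, ?_, ?_, ?_⟩
  · intro i j hij
    apply hC.inj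
    rw [← hammingDist_eq_zero, ← key, hammingDist_eq_zero]
    exact hij
  · simpa only [key] using hC.adj
  · simpa only [key] using hC.induced
  · simpa only [key] using hC.spread

lemma ExistsCircuitCode.mono {n m k N : ℕ} (h : ExistsCircuitCode n k N) (hnm : n ≤ m) :
    ExistsCircuitCode m k N := by
  induction hnm with
  | refl => exact h
  | step _ ih => exact ih.succ

/-- The vertex reached from the origin by flipping the coordinates listed in `w`. -/
def wordVertex {n : ℕ} (w : List (Fin n)) : Fin n → Bool := fun b => (w.count b).bodd

/-- A word over the six coordinates of a cube together with the extra letter `none`. Read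
periodically, any two positions in it are separated by at least four letters, when the occurrences
of `none` are counted with multiplicity and all other letters modulo two, unless they are separated
by fewer than four letters. -/
def spiralWord : List (Option (Fin 6)) :=
  [none, some 0, some 1, none, some 2, some 3, some 0, some 4, some 1, some 5,
   none, some 3, some 4, none, some 0, some 2, some 3, some 5, some 4, some 1,
   none, some 2, some 5, none, some 3, some 0, some 2, some 1, some 5, some 4]

/-- The number of letters `none` among the first `r` letters of `spiralWord`. -/
def spiralHeight (r : ℕ) : ℤ := (spiralWord.take r).count none

/-- The vertex reached by the first `r` letters of `spiralWord`. -/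
def spiralVertex (r : ℕ) : Fin 6 → Bool := wordVertex ((spiralWord.take r).reduceOption)

lemma spiralHeight_mem (r : Fin 30) : 0 ≤ spiralHeight r ∧ spiralHeight r ≤ 6 := by
  decide +kernel +revert

lemma spiral_adj (r : Fin 29) :
    (spiralHeight (r + 1) = spiralHeight r ∧
      hammingDist (spiralVertex r) (spiralVertex (r + 1)) = 1) ∨
    (spiralHeight (r + 1) = spiralHeight r + 1 ∧ spiralVertex (r + 1) = spiralVertex r) := by
  decide +kernel +revert

lemma spiral_adj_last : spiralHeight 29 = spiralHeight 0 + 6 ∧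
    hammingDist (spiralVertex 29) (spiralVertex 0) = 1 := by
  decide +kernel

lemma spiral_spread (e : Fin 3) (r s : Fin 30)
    (h : (6 * ((e : ℤ) - 1) + spiralHeight s - spiralHeight r).natAbs +
      hammingDist (spiralVertex r) (spiralVertex s) < 4) :
    (30 * ((e : ℤ) - 1) + s - r).natAbs ≤
      (6 * ((e : ℤ) - 1) + spiralHeight s - spiralHeight r).natAbs +
      hammingDist (spiralVertex r) (spiralVertex s) := by
  decide +kernel +revert

/-- The `ℤ`-coordinate of the periodic path in `ℤ × {0,1}^6` described by `spiralWord`. -/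
def pathHeight (t : ℤ) : ℤ := 6 * (t / 30) + spiralHeight (t % 30).toNat

/-- The cube coordinate of the periodic path in `ℤ × {0,1}^6` described by `spiralWord`. -/
def pathVertex (t : ℤ) : Fin 6 → Bool := spiralVertex (t % 30).toNat

lemma pathHeight_add (t q : ℤ) : pathHeight (t + 30 * q) = pathHeight t + 6 * q := by
  simp only [pathHeight, Int.add_mul_emod_self_left]
  rw [Int.add_mul_ediv_left _ _ (by norm_num)]
  ring

lemma pathVertex_add (t q : ℤ) : pathVertex (t + 30 * q) = pathVertex t := by
  simp only [pathVertex, Int.add_mul_emod_self_left]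

lemma exists_mod_thirty (t : ℤ) : ∃ (q : ℤ) (r : Fin 30), t = r + 30 * q :=
  ⟨t / 30, ⟨(t % 30).toNat, by omega⟩, by simp only []; omega⟩

lemma pathHeight_fin (r : Fin 30) : pathHeight r = spiralHeight r := by
  have h1 : ((r : ℕ) : ℤ) / 30 = 0 := by omega
  have h2 : (((r : ℕ) : ℤ) % 30).toNat = r := by omega
  rw [pathHeight, h1, h2, mul_zero, zero_add]

lemma pathVertex_fin (r : Fin 30) : pathVertex r = spiralVertex r := by
  have h2 : (((r : ℕ) : ℤ) % 30).toNat = r := by omega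
  rw [pathVertex, h2]

lemma path_adj (t : ℤ) :
    (pathHeight (t + 1) = pathHeight t ∧ hammingDist (pathVertex t) (pathVertex (t + 1)) = 1) ∨
    (pathHeight (t + 1) = pathHeight t + 1 ∧ pathVertex (t + 1) = pathVertex t) := by
  obtain ⟨q, r, rfl⟩ := exists_mod_thirty t
  rw [add_right_comm]
  simp only [pathHeight_add, pathVertex_add, pathHeight_fin, pathVertex_fin]
  by_cases hr : (r : ℕ) < 29
  · have h := spiral_adj ⟨r, hr⟩
    have h1 := pathHeight_fin ⟨r + 1, by omega⟩
    have h2 := pathVertex_fin ⟨r + 1, by omega⟩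
    push_cast at h1 h2
    rw [h1, h2]
    rcases h with h | h
    · exact Or.inl ⟨by rw [h.1], h.2⟩
    · exact Or.inr ⟨by rw [h.1]; ring, h.2⟩
  · have hr' : (r : ℕ) = 29 := by omega
    have h1 := pathHeight_add 0 1
    have h2 := pathVertex_add 0 1
    have h3 := pathHeight_fin 0
    have h4 := pathVertex_fin 0
    simp only [Fin.val_zero, Nat.cast_zero] at h3 h4
    rw [hr', show (((29 : ℕ) : ℤ) + 1) = 0 + 30 * 1 by norm_num, h1, h2, h3, h4]
    exact Or.inl ⟨by rw [spiral_adj_last.1]; ring, spiral_adj_last.2⟩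

lemma path_spread (t u : ℤ)
    (h : (pathHeight u - pathHeight t).natAbs + hammingDist (pathVertex t) (pathVertex u) < 4) :
    (u - t).natAbs ≤
      (pathHeight u - pathHeight t).natAbs + hammingDist (pathVertex t) (pathVertex u) := by
  obtain ⟨q, r, rfl⟩ := exists_mod_thirty t
  obtain ⟨p, s, rfl⟩ := exists_mod_thirty u
  simp only [pathHeight_add, pathVertex_add, pathHeight_fin, pathVertex_fin] at h ⊢
  have hr := spiralHeight_mem r
  have hs := spiralHeight_mem s
  have he : ∃ e : Fin 3, p = q + (e - 1) :=
    ⟨⟨(p - q + 1).toNat, by omega⟩, by simp only []; omega⟩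
  obtain ⟨e, rfl⟩ := he
  have h1 : spiralHeight s + 6 * (q + ((e : ℤ) - 1)) - (spiralHeight r + 6 * q) =
      6 * ((e : ℤ) - 1) + spiralHeight s - spiralHeight r := by ring
  have h2 : (s : ℤ) + 30 * (q + ((e : ℤ) - 1)) - (r + 30 * q) = 30 * ((e : ℤ) - 1) + s - r := by
    ring
  rw [h1] at h ⊢
  rw [h2]
  exact spiral_spread e r s h

/-- Winding the periodic path of `spiralWord` around a code of spread four adds six dimensions and
multiplies the length by five. -/
lemma ExistsCircuitCode.add_six {n M : ℕ} (hM : M ≠ 0) (h : ExistsCircuitCode n 4 (6 * M)) :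
    ExistsCircuitCode (n + 6) 4 (6 * (5 * M)) := by
  obtain ⟨C, hC⟩ := h
  have : NeZero (6 * M) := ⟨by omega⟩
  have : NeZero (6 * (5 * M)) := ⟨by omega⟩
  have cast_zero : ∀ q : ℤ, ((6 * (M * q) : ℤ) : ZMod (6 * M)) = 0 := fun q => by
    rw [ZMod.intCast_zmod_eq_zero_iff_dvd]
    exact ⟨q, by push_cast; ring⟩
  have shift : ∀ q : ℤ, ((6 * (5 * M) : ℕ) : ℤ) * q = 30 * (M * q) := fun q => by
    push_cast; ring
  refine ExistsCircuitCode.of_periodic (by norm_num)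
    (fun t => Fin.append (C (pathHeight t : ZMod (6 * M))) (pathVertex t)) ?_ ?_ ?_
  · intro t q
    simp only [shift, pathHeight_add, pathVertex_add]
    rw [Int.cast_add, cast_zero, add_zero]
  · intro t
    rw [hammingDist_append]
    rcases path_adj t with ⟨h1, h2⟩ | ⟨h1, h2⟩
    · rw [h1, h2, hammingDist_self]
    · rw [h1, h2, hammingDist_self, Int.cast_add, Int.cast_one, hC.adj]
  · intro t u
    rw [hammingDist_append]
    intro h
    obtain ⟨x, hx, hx'⟩ := exists_natAbs_eq_cycDist
      (pathHeight t : ZMod (6 * M)) (pathHeight u : ZMod (6 * M))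
    rw [hC.spread _ _ (by omega)] at hx'
    have hdvd : ((6 * M : ℕ) : ℤ) ∣ x - (pathHeight u - pathHeight t) := by
      rw [← ZMod.intCast_eq_intCast_iff_dvd_sub]
      push_cast
      exact hx
    obtain ⟨q, hq⟩ := hdvd
    push_cast at hq
    have hh : pathHeight (u + 30 * (M * q)) - pathHeight t = x := by
      rw [pathHeight_add]
      linarith
    have hp := path_spread t (u + 30 * (M * q))
    rw [hh, pathVertex_add, hx'] at hp
    refine ⟨q, ?_⟩
    rw [shift]
    exact hp h

/-- The closed walk from the origin with transition sequence `w` repeated twice. -/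
def doubledWalk {n : ℕ} (w : List (Fin n)) (i : ℕ) : Fin n → Bool :=
  wordVertex ((w ++ w).take i)

lemma existsCircuitCode_nine : ExistsCircuitCode 9 4 24 :=
  ⟨fun i => doubledWalk [0, 1, 2, 3, 4, 0, 5, 6, 3, 2, 7, 8] i.val,
    IsCircuitCode.of_cycDist_le (by norm_num) (by decide +kernel) (by decide +kernel)⟩

lemma existsCircuitCode_ten : ExistsCircuitCode 10 4 30 :=
  ⟨fun i => doubledWalk [0, 1, 2, 3, 4, 0, 5, 6, 3, 1, 7, 4, 8, 5, 9] i.val,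
    IsCircuitCode.of_cycDist_le (by norm_num) (by decide +kernel) (by decide +kernel)⟩

lemma existsCircuitCode_twelve : ExistsCircuitCode 12 4 42 :=
  ⟨fun i => doubledWalk [0, 1, 2, 3, 4, 0, 5, 6, 3, 1, 7, 4, 0, 3, 2, 1, 8, 6, 4, 9, 10] i.val,
    IsCircuitCode.of_cycDist_le (by norm_num) (by decide +kernel) (by decide +kernel)⟩

lemma existsCircuitCode_thirteen : ExistsCircuitCode 13 4 60 :=
  ⟨fun i => doubledWalk [0, 1, 2, 3, 4, 0, 5, 6, 3, 1, 7, 4, 0, 3, 2, 1, 8, 6, 0, 3, 4, 9, 1, 5, 2,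
      10, 9, 4, 11, 12] i.val,
    IsCircuitCode.of_cycDist_le (by norm_num) (by decide +kernel) (by decide +kernel)⟩

lemma le_K {n k N : ℕ} (h : ExistsCircuitCode n k N) : N ≤ K n k := by
  refine le_csSup ⟨2 ^ n, ?_⟩ h
  rintro M ⟨C, hC⟩
  rcases Nat.eq_zero_or_pos M with rfl | hM
  · exact Nat.zero_le _
  · have : NeZero M := ⟨hM.ne'⟩
    simpa [ZMod.card] using Fintype.card_le_of_injective C hC.inj

lemma three_rpow_one_third_le : (3 : ℝ) ^ (1 / 3 : ℝ) ≤ 3 / 2 := by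
  have h : ((3 : ℝ) ^ (1 / 3 : ℝ)) ^ 3 = 3 := by
    rw [← Real.rpow_natCast, ← Real.rpow_mul (by norm_num)]
    norm_num
  by_contra! hlt
  have hlt' := pow_lt_pow_left₀ hlt (by norm_num) (n := 3) (by norm_num)
  rw [h] at hlt'
  norm_num at hlt'

lemma three_rpow_neg_one_third_le : (3 : ℝ) ^ (-1 / 3 : ℝ) ≤ 3 / 4 := by
  have h : ((3 : ℝ) ^ (-1 / 3 : ℝ)) ^ 3 = 1 / 3 := by
    rw [← Real.rpow_natCast, ← Real.rpow_mul (by norm_num)]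
    norm_num [Real.rpow_neg_one]
  by_contra! hlt
  have hlt' := pow_lt_pow_left₀ hlt (by norm_num) (n := 3) (by norm_num)
  rw [h] at hlt'
  norm_num at hlt'

/-- For every `n ≥ 6` there is a sufficiently long code of spread four whose length is a multiple
of six. -/
lemma exists_long_code (n : ℕ) : ∃ M : ℕ, M ≠ 0 ∧
    (40 : ℝ) * 3 ^ ((((n + 6 : ℕ) : ℝ) - 8) / 3) ≤ ((6 * M : ℕ) : ℝ) ∧
    ExistsCircuitCode (153 * (n + 6) / 100) 4 (6 * M) := by
  have a1 := three_rpow_one_third_le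
  have a2 := three_rpow_neg_one_third_le
  have a0 : (0 : ℝ) < 3 ^ (-1 / 3 : ℝ) := by positivity
  induction n using Nat.strong_induction_on with
  | _ n ih =>
  match n with
  | 0 =>
    refine ⟨4, by norm_num, ?_, existsCircuitCode_nine⟩
    have h : (3 : ℝ) ^ (-2 / 3 : ℝ) = 3 ^ (-1 / 3 : ℝ) * 3 ^ (-1 / 3 : ℝ) := by
      rw [← Real.rpow_add (by norm_num)]
      norm_num
    norm_num at h a0 a2 ⊢
    rw [h]
    nlinarith
  | 1 =>
    refine ⟨5, by norm_num, ?_, existsCircuitCode_ten⟩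
    norm_num at a2 ⊢
    linarith
  | 2 => exact ⟨7, by norm_num, by norm_num, existsCircuitCode_twelve⟩
  | 3 =>
    refine ⟨10, by norm_num, ?_, existsCircuitCode_thirteen⟩
    norm_num at a1 ⊢
    linarith
  | n + 4 =>
    obtain ⟨M, hM, hlen, hex⟩ := ih n (by omega)
    refine ⟨5 * M, by omega, ?_, (hex.add_six hM).mono (by omega)⟩
    have h : (3 : ℝ) ^ ((((n + 4 + 6 : ℕ) : ℝ) - 8) / 3) =
        3 ^ ((((n + 6 : ℕ) : ℝ) - 8) / 3) * (3 * 3 ^ (1 / 3 : ℝ)) := by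
      rw [← Real.rpow_one_add' (by norm_num) (by norm_num), ← Real.rpow_add (by norm_num)]
      congr 1
      push_cast
      ring
    have hp : (0 : ℝ) < 3 ^ ((((n + 6 : ℕ) : ℝ) - 8) / 3) := by positivity
    rw [h]
    push_cast at hlen hp ⊢
    nlinarith

theorem stmt_1 (n : ℕ) (hn : 6 ≤ n) :
    (40 : ℝ) * 3 ^ (((n : ℝ) - 8) / 3) ≤ (K ⌊(1.53 : ℝ) * n⌋₊ 4 : ℝ) := by
  obtain ⟨m, rfl⟩ := Nat.exists_eq_add_of_le' hn
  have hfloor : ⌊(1.53 : ℝ) * ((m + 6 : ℕ) : ℝ)⌋₊ = 153 * (m + 6) / 100 := by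
    rw [← Nat.floor_div_eq_div (K := ℝ)]
    congr 1
    push_cast
    ring
  obtain ⟨M, hM, hlen, hex⟩ := exists_long_code m
  rw [hfloor]
  exact hlen.trans (by exact_mod_cast le_K hex)
end

section
/- Let C be an (n,k) circuit code of even length N ≥ 2(k+1) with transition sequence T, let C' be the (n+r, k+1) circuit code of length N + 2q produced by the insertion construction (with q = ⌈N/(2(k+1))⌉ and r = ⌈log₂ q⌉ + 1), and let T' be its transition sequence. For vertices x, x' of C', write x* for the projection of x onto the first n coordinates; then x*, x'* are vertices of C. If T̂ is a shortest transition sequence in T' from x to x' (i.e., the arc of T' between the positions of x and x' with the fewer elements), then the subsequence of T̂ consisting of its elements lying in the original coordinate set {1, …, n} is a shortest transition sequence in T between x* and x'*. -/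
/-- The vertex of `I(n)` reached from the all-zeros vertex after applying the first
`p` transitions of the transition sequence `T` (coordinate `i` is set iff it has
been flipped an odd number of times). -/
def vertexAt {n : ℕ} (T : List (Fin n)) (p : ℕ) : Fin n → Bool :=
  fun i => decide (Odd ((T.take p).count i))

/-- `T` is the transition sequence (with `x₁ = 0`) of an `(n,k)` circuit code. -/
def IsCircuitCodeTS (n k : ℕ) (T : List (Fin n)) : Prop :=
  IsCircuitCode n k T.length (fun i : ZMod T.length => vertexAt T i.val)

/-- The arc (segment) of the cyclic sequence `L` going forward from position `p`
(inclusive) to position `p'` (exclusive). -/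
def arc {α : Type*} (L : List α) (p p' : ℕ) : List α :=
  if p ≤ p' then (L.drop p).take (p' - p) else L.drop p ++ L.take p'

/-- One modified half of the insertion construction: the half `half` of the original
transition sequence is divided into `q` consecutive segments of length `k+1` (the last
possibly shorter); at the end of segment `j` (`1 ≤ j ≤ q-1`) the new coordinate
`s_l = n + (l-1)` is inserted, where `2^(l-1)` is the largest power of `2` dividing `j`,
and at the end of segment `q` the new coordinate `s_r = n + (r-1)` is inserted.
(The `min _ (r-1)` clamp only serves to make the definition total; it is the identity
whenever `r = ⌈log₂ q⌉ + 1`.) -/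
def modHalf (n k r q : ℕ) (half : List (Fin n)) : List (Fin (n + r)) :=
  (List.range q).flatMap fun j =>
    ((half.drop (j * (k + 1))).take (k + 1)).map (Fin.castAdd r) ++
      if hr : 0 < r then
        [⟨n + min (if j + 1 = q then r - 1 else padicValNat 2 (j + 1)) (r - 1), by
          have h1 : min (if j + 1 = q then r - 1 else padicValNat 2 (j + 1)) (r - 1) ≤ r - 1 :=
            Nat.min_le_right _ _
          omega⟩]
      else []

theorem filter_take_drop_of_filter_eq_map {α β : Type*} {P : α → Bool} {f : β → α}
    {L : List α} {T : List β} (h : L.filter P = T.map f) (s : ℕ) :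
    (L.take s).filter P = (T.take ((L.take s).filter P).length).map f ∧
      (L.drop s).filter P = (T.drop ((L.take s).filter P).length).map f := by
  have h' : (L.take s).filter P ++ (L.drop s).filter P = T.map f := by
    rw [← List.filter_append, List.take_append_drop, h]
  constructor
  · rw [List.map_take, ← h', List.take_left]
  · rw [List.map_drop, ← h', List.drop_left]

theorem length_filter_take_mono {α : Type*} (P : α → Bool) (L : List α) :
    Monotone fun s => ((L.take s).filter P).length := fun _ _ hab =>
  ((List.take_sublist_take_left hab).filter P).length_le

theorem arc_of_le {α : Type*} (L : List α) {p p' : ℕ} (h : p ≤ p') :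
    arc L p p' = (L.take p').drop p := by
  rw [arc, if_pos h, List.drop_take]

theorem arc_of_lt {α : Type*} (L : List α) {p p' : ℕ} (h : p' < p) :
    arc L p p' = L.drop p ++ L.take p' := by
  rw [arc, if_neg (not_le.mpr h)]

/-- A forward arc without wrap-around projects to the arc between the projected positions. -/
theorem filter_arc_of_le {α β : Type*} {P : α → Bool} {f : β → α}
    {L : List α} {T : List β} (h : L.filter P = T.map f) {p p' : ℕ} (hp : p ≤ p') :
    (arc L p p').filter P =
      (arc T ((L.take p).filter P).length ((L.take p').filter P).length).map f := by
  rw [arc_of_le _ hp, arc_of_le _ (length_filter_take_mono P L hp)]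
  have := (filter_take_drop_of_filter_eq_map
    (filter_take_drop_of_filter_eq_map h p').1 p).2
  rwa [List.take_take, min_eq_left hp] at this

/-- A shortest arc projects to a shortest arc, provided that the projected positions advance
by half of the projected length whenever the position advances by half of the length. -/
theorem filter_shortest_arc {α β : Type*} {P : α → Bool} {f : β → α}
    {L : List α} {T : List β} (h : L.filter P = T.map f) {M H : ℕ}
    (hL : L.length = 2 * M) (hT : T.length = 2 * H) (hH : 0 < H)
    (φ : ℕ → ℕ) (hφ : φ = fun s => ((L.take s).filter P).length)
    (hper : ∀ s ≤ M, φ (s + M) = φ s + H)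
    {p p' : ℕ} (hpp : p ≤ p') (hp' : p' < 2 * M) (S : List α)
    (hS : S = arc L p p' ∨ S = arc L p' p)
    (hshort : S.length = min (arc L p p').length (arc L p' p).length) :
    (S.filter P = (arc T (φ p) (φ p')).map f ∨ S.filter P = (arc T (φ p') (φ p)).map f) ∧
      (S.filter P).length = min (arc T (φ p) (φ p')).length (arc T (φ p') (φ p)).length := by
  have hmono : Monotone φ := hφ ▸ length_filter_take_mono P L
  have hzero : φ 0 = 0 := by simp [hφ]
  have hM : φ M = H := by have := hper 0 (Nat.zero_le _); simpa [hzero] using this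
  have hend : φ (2 * M) = 2 * H := by rw [two_mul, hper M le_rfl, hM, two_mul]
  have hle : φ p ≤ φ p' := hmono hpp
  have hle' : φ p' ≤ 2 * H := hend ▸ hmono hp'.le
  have hfwd : (arc L p p').filter P = (arc T (φ p) (φ p')).map f := by
    rw [filter_arc_of_le h hpp, hφ]
  have hfwd_len : (arc T (φ p) (φ p')).length = φ p' - φ p := by
    rw [arc_of_le _ hle, List.length_drop, List.length_take]; omega
  rcases hpp.eq_or_lt with rfl | hlt
  · have hS' : S = arc L p p := by tauto
    subst hS'
    exact ⟨Or.inl hfwd, by rw [hfwd, List.length_map, min_self]⟩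
  have hLf : (arc L p p').length = p' - p := by
    rw [arc_of_le _ hpp, List.length_drop, List.length_take]; omega
  have hLb : (arc L p' p).length = 2 * M - (p' - p) := by
    rw [arc_of_lt _ hlt, List.length_append, List.length_drop, List.length_take]; omega
  rw [hLf, hLb] at hshort
  have hbwd_len (hne : φ p < φ p') :
      (arc T (φ p') (φ p)).length = 2 * H - (φ p' - φ p) := by
    rw [arc_of_lt _ hne, List.length_append, List.length_drop, List.length_take]; omega
  rcases hS with rfl | rfl
  · refine ⟨Or.inl hfwd, ?_⟩
    rw [hfwd, List.length_map, hfwd_len]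
    rcases hle.eq_or_lt with heq | hne
    · omega
    rw [hbwd_len hne]
    have : φ p' ≤ φ p + H := by
      rcases le_total p M with hpM | hpM
      · rw [← hper p hpM]; exact hmono (by omega)
      · have := hmono hpM; omega
    omega
  · have hge : φ p + H ≤ φ p' := by
      rw [← hper p (by omega)]; exact hmono (by omega)
    have hne : φ p < φ p' := by omega
    have hbwd : (arc L p' p).filter P = (arc T (φ p') (φ p)).map f := by
      rw [arc_of_lt _ hlt, arc_of_lt _ hne, List.filter_append, List.map_append, hφ]
      congr 1
      · exact (filter_take_drop_of_filter_eq_map h p').2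
      · exact (filter_take_drop_of_filter_eq_map h p).1
    refine ⟨Or.inr hbwd, ?_⟩
    rw [hbwd, List.length_map, hfwd_len, hbwd_len hne]
    omega

/-- If two blocks of length `M` have the same `P`-pattern, advancing by `M` inside their
concatenation adds the number of `P`-entries of a block. -/
theorem length_filter_take_append_add {α : Type*} {P : α → Bool} {A B : List α}
    (h : A.map P = B.map P) (s : ℕ) (hs : s ≤ A.length) :
    (((A ++ B).take (s + A.length)).filter P).length =
      (((A ++ B).take s).filter P).length + (A.filter P).length := by
  have key (X : List α) : (X.filter P).length = (X.map P).countP id := by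
    rw [← List.countP_eq_length_filter, List.countP_map]; rfl
  rw [List.take_append_of_le_length hs, Nat.add_comm s, List.take_length_add_append,
    List.filter_append, List.length_append, Nat.add_comm]
  congr 1
  rw [key, key, List.map_take, List.map_take, h]

theorem filter_flatMap_segments {n r : ℕ} (h : List (Fin n)) (k m : ℕ)
    (c : ℕ → List (Fin (n + r)))
    (hc : ∀ j, (c j).filter (fun c => decide (c.val < n)) = []) :
    ((List.range m).flatMap fun j =>
      ((h.drop (j * (k + 1))).take (k + 1)).map (Fin.castAdd r) ++ c j).filter
        (fun c => decide (c.val < n)) = (h.take (m * (k + 1))).map (Fin.castAdd r) := by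
  induction m with
  | zero => simp
  | succ m ih =>
    have hall (X : List (Fin n)) : (X.map (Fin.castAdd r)).filter
        (fun c => decide (c.val < n)) = X.map (Fin.castAdd r) := by
      rw [List.filter_eq_self]; simp
    rw [List.range_succ, List.flatMap_append, List.filter_append, ih, List.flatMap_singleton,
      List.filter_append, hc, hall, List.append_nil, ← List.map_append, Nat.succ_mul,
      List.take_add (i := m * (k + 1))]

theorem filter_modHalf (n k r q : ℕ) (h : List (Fin n)) (hq : h.length ≤ q * (k + 1)) :
    (modHalf n k r q h).filter (fun c => decide (c.val < n)) = h.map (Fin.castAdd r) := by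
  rw [modHalf, filter_flatMap_segments, List.take_of_length_le hq]
  intro j
  split_ifs <;> simp

theorem map_modHalf_congr (n k r q : ℕ) (h h' : List (Fin n)) (hl : h.length = h'.length) :
    (modHalf n k r q h).map (fun c => decide (c.val < n)) =
      (modHalf n k r q h').map (fun c => decide (c.val < n)) := by
  have hrep (X : List (Fin n)) : (X.map (Fin.castAdd r)).map (fun c => decide (c.val < n)) =
      List.replicate X.length true := by
    simp [List.eq_replicate_iff]
  simp only [modHalf, List.map_flatMap, List.map_append, hrep, List.length_take,
    List.length_drop, hl]

theorem length_modHalf (n k r q : ℕ) (h : List (Fin n)) (hr : 0 < r)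
    (hq : h.length ≤ q * (k + 1)) : (modHalf n k r q h).length = h.length + q := by
  have hseg (m : ℕ) : ((List.range m).map fun j =>
      min (k + 1) (h.length - j * (k + 1)) + 1).sum = min h.length (m * (k + 1)) + m := by
    induction m with
    | zero => simp
    | succ m ih =>
      rw [List.range_succ, List.map_append, List.sum_append, ih, Nat.succ_mul]
      simp only [List.map_cons, List.map_nil, List.sum_cons, List.sum_nil]
      omega
  rw [modHalf, List.length_flatMap]
  simp only [hr, dite_true, List.length_append, List.length_map, List.length_take,
    List.length_drop, List.length_singleton]
  rw [hseg, min_eq_left hq]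

theorem vertexAt_castAdd {n r : ℕ} {L : List (Fin (n + r))} {T : List (Fin n)}
    (h : L.filter (fun c => decide (c.val < n)) = T.map (Fin.castAdd r)) (p : ℕ) (i : Fin n) :
    vertexAt L p (Fin.castAdd r i) =
      vertexAt T ((L.take p).filter (fun c => decide (c.val < n))).length i := by
  have hi : (L.take p).count (Fin.castAdd r i) =
      ((L.take p).filter (fun c => decide (c.val < n))).count (Fin.castAdd r i) := by
    rw [List.count_filter]; simp
  have hcount := congrArg (List.count (Fin.castAdd r i))
    (filter_take_drop_of_filter_eq_map h p).1
  rw [List.count_map_of_injective _ _ (Fin.castAdd_injective n r)] at hcount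
  rw [vertexAt, vertexAt, hi, hcount]

theorem stmt_12 (n k N q r : ℕ) (T : List (Fin n))
    (hT : IsCircuitCodeTS n k T) (hN : N = T.length) (hNeven : Even N)
    (hNk : 2 * (k + 1) ≤ N)
    (hq : q = ⌈(N : ℝ) / (2 * (k + 1))⌉₊)
    (hr : r = ⌈Real.logb 2 (q : ℝ)⌉₊ + 1)
    (T' : List (Fin (n + r)))
    (hT' : T' = modHalf n k r q (T.take (N / 2)) ++ modHalf n k r q (T.drop (N / 2)))
    -- positions of the vertices x and x' of C'
    (p p' : ℕ) (hp : p < N + 2 * q) (hp' : p' < N + 2 * q)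
    -- the position in T of the projection of a vertex of C' onto the first n coordinates
    (φ : ℕ → ℕ) (hφ : φ = fun s => ((T'.take s).filter (fun c => decide (c.val < n))).length)
    -- T̂ is a shortest transition sequence in T' between x and x'
    (That : List (Fin (n + r)))
    (hThat : That = arc T' p p' ∨ That = arc T' p' p)
    (hshort : That.length = min (arc T' p p').length (arc T' p' p).length) :
    -- the projections x* and x'* are the vertices of C at positions φ p and φ p'
    (∀ i : Fin n, vertexAt T' p (Fin.castAdd r i) = vertexAt T (φ p) i) ∧
    (∀ i : Fin n, vertexAt T' p' (Fin.castAdd r i) = vertexAt T (φ p') i) ∧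
    -- the subsequence of T̂ of elements lying in the original coordinate set
    -- is a shortest transition sequence in T between x* and x'*
    ((That.filter (fun c => decide (c.val < n)) = (arc T (φ p) (φ p')).map (Fin.castAdd r) ∨
      That.filter (fun c => decide (c.val < n)) = (arc T (φ p') (φ p)).map (Fin.castAdd r)) ∧
     (That.filter (fun c => decide (c.val < n))).length =
       min (arc T (φ p) (φ p')).length (arc T (φ p') (φ p)).length) := by
  obtain ⟨H, hH⟩ := hNeven
  have hHq : H ≤ q * (k + 1) := by
    have h1 : (N : ℝ) / (2 * (k + 1)) ≤ q := hq ▸ Nat.le_ceil _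
    rw [div_le_iff₀ (by positivity), hH] at h1
    have h2 : H + H ≤ q * (2 * (k + 1)) := by exact_mod_cast h1
    nlinarith
  have hN2 : N / 2 = H := by omega
  rw [hN2] at hT'
  have hl1 : (T.take H).length = H := by rw [List.length_take]; omega
  have hl2 : (T.drop H).length = H := by rw [List.length_drop]; omega
  have hr0 : 0 < r := by omega
  have hA := length_modHalf n k r q (T.take H) hr0 (hl1.le.trans hHq)
  have hB := length_modHalf n k r q (T.drop H) hr0 (hl2.le.trans hHq)
  have hfA := filter_modHalf n k r q (T.take H) (hl1.le.trans hHq)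
  have hfB := filter_modHalf n k r q (T.drop H) (hl2.le.trans hHq)
  have hfilter : T'.filter (fun c => decide (c.val < n)) = T.map (Fin.castAdd r) := by
    rw [hT', List.filter_append, hfA, hfB, ← List.map_append, List.take_append_drop]
  have hlen : T'.length = 2 * (H + q) := by
    rw [hT', List.length_append, hA, hB, hl1, hl2]; ring
  have hper : ∀ s ≤ H + q, φ (s + (H + q)) = φ s + H := by
    intro s hs
    have := length_filter_take_append_add
      (map_modHalf_congr n k r q (T.take H) (T.drop H) (hl1.trans hl2.symm)) s
      (by rw [hA, hl1]; exact hs)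
    rwa [hfA, hA, List.length_map, hl1, ← hT', ← congrFun hφ (s + (H + q)),
      ← congrFun hφ s] at this
  refine ⟨fun i => hφ ▸ vertexAt_castAdd hfilter p i,
    fun i => hφ ▸ vertexAt_castAdd hfilter p' i, ?_⟩
  rcases le_total p p' with hpp | hpp
  · exact filter_shortest_arc hfilter hlen (by omega) (by omega) φ hφ hper hpp (by omega)
      That hThat hshort
  · rw [min_comm] at hshort
    rw [or_comm, min_comm]
    exact filter_shortest_arc hfilter hlen (by omega) (by omega) φ hφ hper hpp (by omega)
      That hThat.symm hshort
end

section
/- For every natural number n ≥ 86, the real number 40 · 3^((⌊0.6535·n⌋ − 8)/3) is strictly greater than 6 · 2^(⌊2n/6⌋ − 1); that is, the lower bound for K(n,4) from the new construction exceeds the lower bound 6 · 2^(⌊2n/6⌋ − 1) obtained from codes of spread 5. -/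
set_option exponentiation.threshold 2000 in
theorem two_point_zero_five_lt_three_rpow : (2.05 : ℝ) < 3 ^ (0.6535 : ℝ) := by
  refine lt_of_pow_lt_pow_left₀ 2000 (by positivity) ?_
  have h : ((3 : ℝ) ^ (0.6535 : ℝ)) ^ 2000 = 3 ^ 1307 := by
    rw [← Real.rpow_natCast, ← Real.rpow_mul (by norm_num), ← Real.rpow_natCast]
    norm_num
  rw [h]
  norm_num

theorem two_pow_lt_two_point_zero_five_pow {n : ℕ} (hn : 86 ≤ n) :
    (27 : ℝ) * 3 ^ 9 * 2 ^ n < 64000 * 2.05 ^ n := by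
  induction n, hn using Nat.le_induction with
  | base => norm_num
  | succ k _ ih =>
    rw [pow_succ (2 : ℝ), pow_succ (2.05 : ℝ)]
    have : (0 : ℝ) < 2.05 ^ k := by positivity
    linarith

theorem stmt_14 (n : ℕ) (hn : 86 ≤ n) :
    (6 : ℝ) * 2 ^ (2 * n / 6 - 1) <
      40 * 3 ^ (((⌊(0.6535 : ℝ) * n⌋₊ : ℝ) - 8) / 3) := by
  set m := ⌊(0.6535 : ℝ) * n⌋₊
  have hm : (0.6535 : ℝ) * n < m + 1 := Nat.lt_floor_add_one _
  have hcube : ((3 : ℝ) ^ (((m : ℝ) - 8) / 3)) ^ 3 = 3 ^ ((m : ℝ) - 8) := by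
    rw [← Real.rpow_natCast, ← Real.rpow_mul (by norm_num)]
    norm_num
  have hpow : (2.05 : ℝ) ^ n ≤ 3 ^ 9 * 3 ^ ((m : ℝ) - 8) :=
    calc (2.05 : ℝ) ^ n ≤ ((3 : ℝ) ^ (0.6535 : ℝ)) ^ n := by
          gcongr
          exact two_point_zero_five_lt_three_rpow.le
      _ = (3 : ℝ) ^ ((0.6535 : ℝ) * n) := by
          rw [Real.rpow_mul (by norm_num), Real.rpow_natCast]
      _ ≤ (3 : ℝ) ^ ((9 : ℕ) + ((m : ℝ) - 8)) := by
          apply Real.rpow_le_rpow_of_exponent_le (by norm_num)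
          push_cast
          linarith
      _ = 3 ^ 9 * 3 ^ ((m : ℝ) - 8) := by
          rw [Real.rpow_add (by norm_num), Real.rpow_natCast]
  have htwo : ((2 : ℝ) ^ (2 * n / 6 - 1)) ^ 3 * 8 ≤ 2 ^ n :=
    calc ((2 : ℝ) ^ (2 * n / 6 - 1)) ^ 3 * 8 = 2 ^ ((2 * n / 6 - 1) * 3 + 3) := by
          rw [pow_add, pow_mul]
          norm_num
      _ ≤ 2 ^ n := pow_le_pow_right₀ (by norm_num) (by omega)
  refine lt_of_pow_lt_pow_left₀ 3 (by positivity) ?_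
  rw [mul_pow, mul_pow, hcube]
  linarith [two_pow_lt_two_point_zero_five_pow hn]
end
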